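/- For every positive integer n, every co-chain graph on n vertices is an induced subgraph of the canonical graph H_{2,n} (i.e., H_{2,n} is an n-universal co-chain graph). -/

import Mathlib

open SimpleGraph

/-- A graph is a unit interval graph if there is a map `f` to the reals such that
distinct vertices `u, v` are adjacent iff `|f u - f v| ≤ 1`. -/
def IsUnitInterval {V : Type*} (G : SimpleGraph V) : Prop :=
  ∃ f : V → ℝ, ∀ u v : V, u ≠ v → (G.Adj u v ↔ |f u - f v| ≤ 1)

/-- The canonical unit interval graph `H_{n,m}` on vertex set `Fin n × Fin m`:
rows are cliques, and a vertex in row `i+1`, column `j'` is adjacent to a vertex in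
row `i`, column `j` iff `j' ≤ j`. -/
def canonicalGraph (n m : ℕ) : SimpleGraph (Fin n × Fin m) where
  Adj p q := p ≠ q ∧ (p.1 = q.1 ∨
      ((q.1 : ℕ) = (p.1 : ℕ) + 1 ∧ (q.2 : ℕ) ≤ (p.2 : ℕ)) ∨
      ((p.1 : ℕ) = (q.1 : ℕ) + 1 ∧ (p.2 : ℕ) ≤ (q.2 : ℕ)))
  symm := by
    refine ⟨?_⟩
    rintro p q ⟨hne, h⟩
    refine ⟨hne.symm, ?_⟩
    tauto
  loopless := by refine ⟨?_⟩; rintro p ⟨hne, -⟩; exact hne rfl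

/-- Syntactic expressions for clique-width constructions with `k` labels. -/
inductive CWExpr (k : ℕ) : Type where
  | single (i : Fin k) : CWExpr k
  | union (e₁ e₂ : CWExpr k) : CWExpr k
  | join (i j : Fin k) (hij : i ≠ j) (e : CWExpr k) : CWExpr k
  | relabel (i j : Fin k) (e : CWExpr k) : CWExpr k

namespace CWExpr

/-- The vertex type of the graph constructed by an expression. -/
def V {k : ℕ} : CWExpr k → Type
  | single _ => Unit
  | union e₁ e₂ => e₁.V ⊕ e₂.V
  | join _ _ _ e => e.V
  | relabel _ _ e => e.V

/-- The final labelling of the vertices. -/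
def label {k : ℕ} : (e : CWExpr k) → e.V → Fin k
  | single i, _ => i
  | union e₁ _, Sum.inl v => e₁.label v
  | union _ e₂, Sum.inr v => e₂.label v
  | join _ _ _ e, v => e.label v
  | relabel i j e, v => if e.label v = i then j else e.label v

/-- The graph constructed by an expression. -/
def graph {k : ℕ} : (e : CWExpr k) → SimpleGraph e.V
  | single _ => ⊥
  | union e₁ e₂ => e₁.graph ⊕g e₂.graph
  | join i j _ e => e.graph ⊔ SimpleGraph.fromRel (fun u v => e.label u = i ∧ e.label v = j)
  | relabel _ _ e => e.graph

end CWExpr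

/-- `G` has clique-width at most `k`: it is isomorphic to the graph of some
clique-width expression with `k` labels. -/
def CliqueWidthLE {V : Type*} (G : SimpleGraph V) (k : ℕ) : Prop :=
  ∃ e : CWExpr k, Nonempty (G ≃g e.graph)

/-- `U`-similarity: two vertices of `U` are similar if they have the same
neighbourhood outside `U`. -/
def similarSetoid {V : Type*} (G : SimpleGraph V) (U : Set V) : Setoid ↥U where
  r u v := ∀ w ∉ U, (G.Adj u w ↔ G.Adj v w)
  iseqv := ⟨fun _ _ _ => Iff.rfl, fun h w hw => (h w hw).symm,
    fun h₁ h₂ w hw => (h₁ w hw).trans (h₂ w hw)⟩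

/-- `μ_G(U)`: the number of `U`-similarity classes. -/
noncomputable def mu {V : Type*} (G : SimpleGraph V) (U : Set V) : ℕ :=
  Nat.card (Quotient (similarSetoid G U))

/-- A co-chain graph: the vertex set is partitioned into two cliques such that the
neighbourhoods of the vertices of the first clique in the second one are linearly
ordered by inclusion. -/
def IsCoChain {V : Type*} (G : SimpleGraph V) : Prop :=
  ∃ V₁ V₂ : Set V, V₁ ∪ V₂ = Set.univ ∧ Disjoint V₁ V₂ ∧
    G.IsClique V₁ ∧ G.IsClique V₂ ∧
    ∀ u ∈ V₁, ∀ v ∈ V₁,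
      (G.neighborSet u ∩ V₂ ⊆ G.neighborSet v ∩ V₂) ∨
      (G.neighborSet v ∩ V₂ ⊆ G.neighborSet u ∩ V₂)

/-- Any natural-valued function on a finite type is refined by an enumeration of the type. -/
theorem exists_equiv_fin_lt_of_lt {V : Type*} [Fintype V] {n : ℕ} (hcard : Fintype.card V = n)
    (f : V → ℕ) : ∃ e : V ≃ Fin n, ∀ u v, f u < f v → e u < e v := by
  let g : V → ℕ ×ₗ Fin (Fintype.card V) := fun v => toLex (f v, Fintype.equivFin V v)
  have hg : Function.Injective g := fun u v h =>
    (Fintype.equivFin V).injective (congrArg Prod.snd (toLex.injective h))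
  let _ : LinearOrder V := LinearOrder.lift' g hg
  let e : Fin n ≃o V := Fintype.orderIsoFinOfCardEq V hcard
  refine ⟨e.symm.toEquiv, fun u v huv => e.symm.strictMono ?_⟩
  change g u < g v
  exact Prod.Lex.toLex_lt_toLex.mpr (Or.inl huv)

/-- If the neighbourhoods in `V₂` of the vertices of `V₁` form a chain, adjacency between `V₁` and
`V₂` is a comparison of natural weights. -/
theorem exists_weight_of_neighborSet_chain {V : Type*} [Finite V] (G : SimpleGraph V)
    (V₁ V₂ : Set V) (hdisj : Disjoint V₁ V₂)
    (hchain : ∀ u ∈ V₁, ∀ v ∈ V₁,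
      (G.neighborSet u ∩ V₂ ⊆ G.neighborSet v ∩ V₂) ∨
      (G.neighborSet v ∩ V₂ ⊆ G.neighborSet u ∩ V₂)) :
    ∃ f : V → ℕ, ∀ u ∈ V₁, ∀ w ∈ V₂, (G.Adj u w → f w < f u) ∧ (¬ G.Adj u w → f u < f w) := by
  classical
  let S : V → Set V := fun w => {x ∈ V₂ | ∀ u ∈ V₁, G.Adj u w → G.Adj u x}
  refine ⟨fun v => if v ∈ V₁ then 2 * (G.neighborSet v ∩ V₂).ncard + 1 else 2 * (S v).ncard,
    fun u hu w hw => ?_⟩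
  have hw₁ : w ∉ V₁ := fun h => Set.disjoint_left.mp hdisj h hw
  simp only [hu, hw₁, if_true, if_false]
  refine ⟨fun h => ?_, fun h => ?_⟩
  · have : (S w).ncard ≤ (G.neighborSet u ∩ V₂).ncard :=
      Set.ncard_le_ncard (fun x hx => ⟨hx.2 u hu h, hx.1⟩)
    omega
  · have : (G.neighborSet u ∩ V₂).ncard < (S w).ncard := by
      refine Set.ncard_lt_ncard ⟨fun x hx => ⟨hx.2, fun v hv hvw => ?_⟩,
        fun hsub => h (hsub (show w ∈ S w from ⟨hw, fun _ _ h => h⟩)).1⟩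
      rcases hchain u hu v hv with huv | hvu
      · exact (huv hx).1
      · exact absurd (hvu ⟨hvw, hw⟩).1 h
    omega

/-- `H_{2,n}` is an `n`-universal co-chain graph. -/
theorem canonicalGraph_two_nUniversal_coChain (n : ℕ) (hn : 0 < n)
    (V : Type) [Fintype V] (G : SimpleGraph V) (hcard : Fintype.card V = n)
    (hG : IsCoChain G) :
    Nonempty (G ↪g canonicalGraph 2 n) := by
  classical
  obtain ⟨V₁, V₂, hcover, hdisj, hV₁, hV₂, hchain⟩ := hG
  obtain ⟨f, hf⟩ := exists_weight_of_neighborSet_chain G V₁ V₂ hdisj hchain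
  obtain ⟨e, he⟩ := exists_equiv_fin_lt_of_lt hcard f
  have hadj : ∀ u ∈ V₁, ∀ w ∈ V₂, ((e w : ℕ) ≤ e u ↔ G.Adj u w) := fun u hu w hw => by
    refine ⟨fun h => ?_, fun h => (he w u ((hf u hu w hw).1 h)).le⟩
    by_contra hn
    exact absurd (he u w ((hf u hu w hw).2 hn)) (not_lt.mpr h)
  have hmem : ∀ v, v ∉ V₁ → v ∈ V₂ := fun v hv =>
    ((hcover ▸ Set.mem_univ v : v ∈ V₁ ∪ V₂)).resolve_left hv
  let φ : V → Fin 2 × Fin n := fun v => (if v ∈ V₁ then 0 else 1, e v)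
  have hφ : Function.Injective φ := fun u v h => e.injective (congrArg Prod.snd h)
  refine ⟨⟨⟨φ, hφ⟩, fun {u v} => ?_⟩⟩
  change (φ u ≠ φ v ∧ _) ↔ _
  rw [hφ.ne_iff]
  by_cases huv : u = v
  · simp [huv]
  by_cases hu : u ∈ V₁ <;> by_cases hv : v ∈ V₁
  · simp [φ, hu, hv, huv, hV₁ hu hv huv]
  · simpa [φ, hu, hv, huv] using hadj u hu v (hmem v hv)
  · simpa [φ, hu, hv, huv, G.adj_comm u v] using hadj v hv u (hmem u hu)
  · simp [φ, hu, hv, huv, hV₂ (hmem u hu) (hmem v hv) huv]
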